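/- Let K be a number field and F ∈ K[x] an irreducible polynomial whose splitting field L satisfies [L : K] = deg F. Then the Dirichlet density of the set of primes 𝔭 of K for which F has a root in K_𝔭 equals 1/deg F. -/

import Mathlib

open Polynomial NumberField IsDedekindDomain Filter

/-- `S` has Dirichlet density `δ`:
`δ = lim_{s→1⁺} (∑_{𝔭 ∈ S} N(𝔭)^{-s}) / (-log (s-1))`. -/
noncomputable def HasDirichletDensity (K : Type*) [Field K] [NumberField K]
    (S : Set (HeightOneSpectrum (𝓞 K))) (δ : ℝ) : Prop :=
  Tendsto (fun s : ℝ =>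
      (∑' v : S, (Ideal.absNorm (v.1.asIdeal) : ℝ) ^ (-s)) / (-Real.log (s - 1)))
    (nhdsWithin 1 (Set.Ioi 1)) (nhds δ)

section Analytic

variable (K : Type*) [Field K] [NumberField K]

theorem hasSum_absNorm_fiber (s : ℝ) (n : ℕ) :
    HasSum (fun I : {I : Ideal (𝓞 K) // Ideal.absNorm I = n} =>
        (Ideal.absNorm I.1 : ℝ) ^ (-s))
      (Nat.card {I : Ideal (𝓞 K) // Ideal.absNorm I = n} * (n : ℝ) ^ (-s)) := by
  have hfin : Finite {I : Ideal (𝓞 K) // Ideal.absNorm I = n} :=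
    (Ideal.finite_setOfPred_absNorm_eq n).to_subtype
  have := Fintype.ofFinite {I : Ideal (𝓞 K) // Ideal.absNorm I = n}
  convert hasSum_fintype (fun I : {I : Ideal (𝓞 K) // Ideal.absNorm I = n} =>
    (Ideal.absNorm I.1 : ℝ) ^ (-s)) using 1
  rw [Finset.sum_congr rfl (g := fun _ => (n : ℝ) ^ (-s)) (fun I _ => by rw [I.2])]
  simp [Nat.card_eq_fintype_card]

theorem dedekindZeta_term_eq (s : ℝ) (hs : 1 < s) (n : ℕ) :
    LSeries.term (fun n ↦ (Nat.card {I : Ideal (𝓞 K) // Ideal.absNorm I = n} : ℂ)) s n =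
      ((∑' I : {I : Ideal (𝓞 K) // Ideal.absNorm I = n},
        (Ideal.absNorm I.1 : ℝ) ^ (-s) : ℝ) : ℂ) := by
  rw [(hasSum_absNorm_fiber K s n).tsum_eq, LSeries.term]
  split_ifs with h
  · subst h
    simp [Real.zero_rpow (by linarith : -s ≠ 0)]
  · rw [Complex.ofReal_mul, Complex.ofReal_cpow (Nat.cast_nonneg n)]
    simp [Complex.cpow_neg, div_eq_mul_inv]

theorem summable_absNorm_rpow_iff (s : ℝ) (hs : 1 < s) :
    Summable (fun I : Ideal (𝓞 K) => (Ideal.absNorm I : ℝ) ^ (-s)) ↔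
      LSeriesSummable (fun n ↦ (Nat.card {I : Ideal (𝓞 K) // Ideal.absNorm I = n} : ℂ)) s := by
  rw [← (Equiv.sigmaFiberEquiv (fun I : Ideal (𝓞 K) => Ideal.absNorm I)).summable_iff,
    summable_sigma_of_nonneg (fun _ => by simp only [Function.comp]; positivity), LSeriesSummable,
    funext (dedekindZeta_term_eq K s hs), Complex.summable_ofReal]
  exact and_iff_right fun n => (hasSum_absNorm_fiber K s n).summable

theorem dedekindZeta_eq_tsum_absNorm (s : ℝ) (hs : 1 < s)
    (h : Summable (fun I : Ideal (𝓞 K) => (Ideal.absNorm I : ℝ) ^ (-s))) :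
    dedekindZeta K s = ((∑' I : Ideal (𝓞 K), (Ideal.absNorm I : ℝ) ^ (-s) : ℝ) : ℂ) := by
  rw [dedekindZeta, LSeries, funext (dedekindZeta_term_eq K s hs), ← Complex.ofReal_tsum,
    ← (Equiv.sigmaFiberEquiv (fun I : Ideal (𝓞 K) => Ideal.absNorm I)).tsum_eq]
  congr 1
  exact (Summable.tsum_sigma' (f := fun c : (n : ℕ) × {I : Ideal (𝓞 K) // Ideal.absNorm I = n} =>
      (Ideal.absNorm c.2.1 : ℝ) ^ (-s))
    (fun n => (hasSum_absNorm_fiber K s n).summable)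
    ((Equiv.sigmaFiberEquiv (fun I : Ideal (𝓞 K) => Ideal.absNorm I)).summable_iff.mpr h)).symm

theorem summable_absNorm_rpow (s : ℝ) (hs : 1 < s) :
    Summable (fun I : Ideal (𝓞 K) => (Ideal.absNorm I : ℝ) ^ (-s)) := by
  have h1 : ∀ᶠ t : ℝ in nhdsWithin 1 (Set.Ioi 1), (t - 1) * dedekindZeta K t ≠ 0 :=
    (tendsto_sub_one_mul_dedekindZeta_nhdsGT K).eventually_ne
      (by exact_mod_cast dedekindZeta_residue_ne_zero K)
  obtain ⟨t, ht, ht1, hts⟩ :=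
    (h1.and (Ioo_mem_nhdsGT hs)).exists
  have hL : LSeriesSummable
      (fun n ↦ (Nat.card {I : Ideal (𝓞 K) // Ideal.absNorm I = n} : ℂ)) t := by
    by_contra hcon
    apply ht
    rw [dedekindZeta, LSeries, tsum_eq_zero_of_not_summable hcon, mul_zero]
  exact (summable_absNorm_rpow_iff K s hs).mpr (hL.of_re_le_re (by simpa using hts.le))

theorem tendsto_sub_one_mul_tsum_absNorm :
    Tendsto (fun s : ℝ => (s - 1) * ∑' I : Ideal (𝓞 K), (Ideal.absNorm I : ℝ) ^ (-s))
      (nhdsWithin 1 (Set.Ioi 1)) (nhds (dedekindZeta_residue K)) := by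
  have h := (Complex.continuous_re.tendsto _).comp (tendsto_sub_one_mul_dedekindZeta_nhdsGT K)
  rw [Complex.ofReal_re] at h
  refine h.congr' ?_
  filter_upwards [self_mem_nhdsWithin] with s hs
  have hs : 1 < s := hs
  rw [Function.comp, dedekindZeta_eq_tsum_absNorm K s hs (summable_absNorm_rpow K s hs),
    ← Complex.ofReal_one, ← Complex.ofReal_sub, ← Complex.ofReal_mul, Complex.ofReal_re]

variable {K}

theorem two_le_absNorm (v : HeightOneSpectrum (𝓞 K)) : (2 : ℝ) ≤ Ideal.absNorm v.asIdeal := by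
  exact_mod_cast HeightOneSpectrum.one_lt_absNorm v

theorem absNorm_rpow_neg_le_half (v : HeightOneSpectrum (𝓞 K)) {s : ℝ} (hs : 1 ≤ s) :
    (Ideal.absNorm v.asIdeal : ℝ) ^ (-s) ≤ 1 / 2 := by
  have h2 := two_le_absNorm v
  calc (Ideal.absNorm v.asIdeal : ℝ) ^ (-s) ≤ (Ideal.absNorm v.asIdeal : ℝ) ^ (-1 : ℝ) :=
        Real.rpow_le_rpow_of_exponent_le (by linarith) (by linarith)
    _ = 1 / (Ideal.absNorm v.asIdeal : ℝ) := by rw [Real.rpow_neg_one, one_div]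
    _ ≤ 1 / 2 := one_div_le_one_div_of_le (by norm_num) h2

theorem summable_prime_rpow {s : ℝ} (hs : 1 < s) :
    Summable (fun v : HeightOneSpectrum (𝓞 K) => (Ideal.absNorm v.asIdeal : ℝ) ^ (-s)) :=
  (summable_absNorm_rpow K s hs).comp_injective HeightOneSpectrum.asIdeal_injective

theorem prod_asIdeal_injective :
    Function.Injective (fun t : Finset (HeightOneSpectrum (𝓞 K)) => ∏ v ∈ t, v.asIdeal) := by
  have key : ∀ (t : Finset (HeightOneSpectrum (𝓞 K))) v, v ∈ t ↔ v.asIdeal ∣ ∏ v ∈ t, v.asIdeal := by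
    intro t v
    refine ⟨fun h => Finset.dvd_prod_of_mem _ h, fun h => ?_⟩
    obtain ⟨w, hw, hvw⟩ := (v.prime.dvd_finsetProd_iff _).mp h
    have : v = w := HeightOneSpectrum.ext
      (w.isMaximal.eq_of_le v.isPrime.ne_top (Ideal.dvd_iff_le.mp hvw)).symm
    rwa [this]
  intro t u h
  ext v
  rw [key t, key u]
  simp only at h
  rw [h]

theorem sub_sq_le_log_one_add {x : ℝ} (hx : 0 ≤ x) : x - x ^ 2 ≤ Real.log (1 + x) := by
  refine le_trans ?_ (Real.one_sub_inv_le_log_of_pos (by linarith))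
  have : 1 - (1 + x)⁻¹ - (x - x ^ 2) = x ^ 3 / (1 + x) := by field_simp; ring
  have : 0 ≤ x ^ 3 / (1 + x) := by positivity
  linarith

theorem neg_log_one_sub_le {x : ℝ} (hx : 0 ≤ x) (hx2 : x ≤ 1 / 2) :
    -Real.log (1 - x) ≤ x + 2 * x ^ 2 := by
  have h := Real.one_sub_inv_le_log_of_pos (x := 1 - x) (by linarith)
  have h1 : (1 - x)⁻¹ - 1 ≤ x + 2 * x ^ 2 := by
    rw [sub_le_iff_le_add, inv_le_iff_one_le_mul₀ (by linarith)]
    nlinarith [mul_nonneg hx hx, mul_nonneg (mul_nonneg hx hx) (by linarith : 0 ≤ 1 - 2 * x)]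
  linarith

theorem prod_one_add_le_tsum {s : ℝ} (hs : 1 < s) (A : Finset (HeightOneSpectrum (𝓞 K))) :
    ∏ v ∈ A, (1 + (Ideal.absNorm v.asIdeal : ℝ) ^ (-s)) ≤
      ∑' I : Ideal (𝓞 K), (Ideal.absNorm I : ℝ) ^ (-s) := by
  classical
  rw [Finset.prod_one_add]
  have h : ∀ t : Finset (HeightOneSpectrum (𝓞 K)),
      ∏ v ∈ t, (Ideal.absNorm v.asIdeal : ℝ) ^ (-s) =
        (Ideal.absNorm (∏ v ∈ t, v.asIdeal) : ℝ) ^ (-s) := by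
    intro t
    rw [map_prod, Nat.cast_prod, Real.finsetProd_rpow _ _ (fun _ _ => by positivity)]
  rw [Finset.sum_congr rfl (fun t _ => h t),
    ← Finset.sum_image (f := fun I : Ideal (𝓞 K) => (Ideal.absNorm I : ℝ) ^ (-s))
      (fun _ _ _ _ h => prod_asIdeal_injective h)]
  exact (summable_absNorm_rpow K s hs).sum_le_tsum _ (fun _ _ => by positivity)

theorem sum_absNorm_le_prod {s : ℝ} (hs : 1 < s) (B : Finset (Ideal (𝓞 K)))
    (hB : ∀ I ∈ B, I ≠ 0) :
    ∃ A : Finset (HeightOneSpectrum (𝓞 K)),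
      ∑ I ∈ B, (Ideal.absNorm I : ℝ) ^ (-s) ≤
        ∏ v ∈ A, (1 - (Ideal.absNorm v.asIdeal : ℝ) ^ (-s))⁻¹ := by
  classical
  let c : Ideal (𝓞 K) → HeightOneSpectrum (𝓞 K) → ℕ := fun I v =>
    (Associates.mk v.asIdeal).count (Associates.mk I).factors
  have hex : ∀ I : Ideal (𝓞 K), ∃ A : Finset (HeightOneSpectrum (𝓞 K)), I ≠ 0 →
      Function.mulSupport (fun v : HeightOneSpectrum (𝓞 K) => v.maxPowDividing I) ⊆ A := by
    intro I
    by_cases hI : I = 0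
    · exact ⟨∅, fun h => absurd hI h⟩
    · exact ⟨(Ideal.hasFiniteMulSupport hI).toFinset, fun _ =>
        (Set.Finite.coe_toFinset _).symm.subset⟩
  choose A' hA' using hex
  let A := B.biUnion A'
  let N := (B.sup fun I => A.sup fun v => c I v) + 1
  have hfac : ∀ I ∈ B, ∏ v ∈ A, v.asIdeal ^ c I v = I := by
    intro I hI
    have h1 := Ideal.finprod_heightOneSpectrum_factorization (hB I hI)
    rw [finprod_eq_prod_of_mulSupport_subset (s := A) _ ((hA' I (hB I hI)).trans (by
      exact_mod_cast Finset.subset_biUnion_of_mem A' hI))] at h1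
    exact h1
  refine ⟨A, ?_⟩
  have hx : ∀ v : HeightOneSpectrum (𝓞 K), 0 ≤ (Ideal.absNorm v.asIdeal : ℝ) ^ (-s) :=
    fun v => by positivity
  have hx2 := fun v : HeightOneSpectrum (𝓞 K) => absNorm_rpow_neg_le_half v hs.le
  calc ∑ I ∈ B, (Ideal.absNorm I : ℝ) ^ (-s)
      ≤ ∏ v ∈ A, ∑ k ∈ Finset.range N, ((Ideal.absNorm v.asIdeal : ℝ) ^ (-s)) ^ k := by
        rw [Finset.prod_sum]
        let g : Ideal (𝓞 K) → (v : HeightOneSpectrum (𝓞 K)) → v ∈ A → ℕ := fun I v _ => c I v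
        have hg : Set.InjOn g B := by
          intro I hI J hJ hIJ
          rw [← hfac I hI, ← hfac J hJ]
          refine Finset.prod_congr rfl fun v hv => ?_
          have : c I v = c J v := congrFun (congrFun hIJ v) hv
          rw [this]
        have hsub : B.image g ⊆ A.pi fun _ => Finset.range N := by
          intro p hp
          obtain ⟨I, hI, rfl⟩ := Finset.mem_image.mp hp
          refine Finset.mem_pi.mpr fun v hv => Finset.mem_range.mpr (Nat.lt_succ_of_le ?_)
          exact (Finset.le_sup (f := fun v => c I v) hv).trans
            (Finset.le_sup (f := fun I => A.sup fun v => c I v) hI)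
        refine le_trans (le_of_eq ?_) (Finset.sum_le_sum_of_subset_of_nonneg hsub
          fun p _ _ => Finset.prod_nonneg fun v _ => pow_nonneg (hx _) _)
        rw [Finset.sum_image hg]
        refine Finset.sum_congr rfl fun I hI => ?_
        rw [Finset.prod_attach A (fun v => ((Ideal.absNorm v.asIdeal : ℝ) ^ (-s)) ^ c I v)]
        conv_lhs => rw [← hfac I hI]
        rw [map_prod, Nat.cast_prod, ← Real.finsetProd_rpow _ _ (fun _ _ => by positivity)]
        refine Finset.prod_congr rfl fun v _ => ?_
        rw [map_pow, Nat.cast_pow, ← Real.rpow_natCast, ← Real.rpow_natCast,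
          ← Real.rpow_mul (by positivity), ← Real.rpow_mul (by positivity), mul_comm]
    _ ≤ ∏ v ∈ A, (1 - (Ideal.absNorm v.asIdeal : ℝ) ^ (-s))⁻¹ := by
        refine Finset.prod_le_prod (fun v _ => Finset.sum_nonneg fun k _ => pow_nonneg (hx v) k)
          fun v _ => ?_
        have hlt : (Ideal.absNorm v.asIdeal : ℝ) ^ (-s) < 1 := by linarith [hx2 v]
        rw [← tsum_geometric_of_lt_one (hx v) hlt]
        exact (summable_geometric_of_lt_one (hx v) hlt).sum_le_tsum _
          (fun k _ => pow_nonneg (hx v) k)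

theorem absNorm_rpow_sq_le (v : HeightOneSpectrum (𝓞 K)) {s : ℝ} (hs : 1 ≤ s) :
    ((Ideal.absNorm v.asIdeal : ℝ) ^ (-s)) ^ 2 ≤ (Ideal.absNorm v.asIdeal : ℝ) ^ (-2 : ℝ) := by
  have h2 := two_le_absNorm v
  rw [← Real.rpow_natCast, ← Real.rpow_mul (by positivity)]
  exact Real.rpow_le_rpow_of_exponent_le (by linarith) (by push_cast; linarith)

theorem one_le_tsum_absNorm {s : ℝ} (hs : 1 < s) :
    1 ≤ ∑' I : Ideal (𝓞 K), (Ideal.absNorm I : ℝ) ^ (-s) := by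
  simpa using prod_one_add_le_tsum hs (∅ : Finset (HeightOneSpectrum (𝓞 K)))

theorem tsum_prime_sub_le_log {s : ℝ} (hs : 1 < s) :
    ∑' v : HeightOneSpectrum (𝓞 K), (Ideal.absNorm v.asIdeal : ℝ) ^ (-s) ≤
      Real.log (∑' I : Ideal (𝓞 K), (Ideal.absNorm I : ℝ) ^ (-s)) +
        ∑' v : HeightOneSpectrum (𝓞 K), (Ideal.absNorm v.asIdeal : ℝ) ^ (-2 : ℝ) := by
  refine Real.tsum_le_of_sum_le (fun v => by positivity) fun A => ?_
  have h1 := Real.log_le_log (Finset.prod_pos fun v _ => by positivity)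
    (prod_one_add_le_tsum hs A)
  rw [Real.log_prod (fun v _ => by positivity)] at h1
  have h2 : ∑ v ∈ A, (Ideal.absNorm v.asIdeal : ℝ) ^ (-2 : ℝ) ≤ _ :=
    (summable_prime_rpow one_lt_two).sum_le_tsum A (fun _ _ => by positivity)
  have h3 : ∑ v ∈ A, (Ideal.absNorm v.asIdeal : ℝ) ^ (-s) ≤
      ∑ v ∈ A, (Real.log (1 + (Ideal.absNorm v.asIdeal : ℝ) ^ (-s)) +
        (Ideal.absNorm v.asIdeal : ℝ) ^ (-2 : ℝ)) := by
    refine Finset.sum_le_sum fun v _ => ?_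
    have := sub_sq_le_log_one_add (x := (Ideal.absNorm v.asIdeal : ℝ) ^ (-s)) (by positivity)
    linarith [absNorm_rpow_sq_le v hs.le]
  rw [Finset.sum_add_distrib] at h3
  linarith

theorem log_tsum_le {s : ℝ} (hs : 1 < s) :
    Real.log (∑' I : Ideal (𝓞 K), (Ideal.absNorm I : ℝ) ^ (-s)) ≤
      ∑' v : HeightOneSpectrum (𝓞 K), (Ideal.absNorm v.asIdeal : ℝ) ^ (-s) +
        2 * ∑' v : HeightOneSpectrum (𝓞 K), (Ideal.absNorm v.asIdeal : ℝ) ^ (-2 : ℝ) := by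
  classical
  have h1 := one_le_tsum_absNorm (K := K) hs
  rw [Real.log_le_iff_le_exp (by linarith)]
  refine Real.tsum_le_of_sum_le (fun v => by positivity) fun B => ?_
  obtain ⟨A, hA⟩ := sum_absNorm_le_prod hs (B.erase 0) (fun I hI => (Finset.mem_erase.mp hI).1)
  have h0 : ∑ I ∈ B, (Ideal.absNorm I : ℝ) ^ (-s) =
      ∑ I ∈ B.erase 0, (Ideal.absNorm I : ℝ) ^ (-s) :=
    (Finset.sum_erase B (by simp [Real.zero_rpow (by linarith : -s ≠ 0)])).symm
  rw [h0]
  have hx2 := fun v : HeightOneSpectrum (𝓞 K) => absNorm_rpow_neg_le_half v hs.le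
  have hpos : ∀ v : HeightOneSpectrum (𝓞 K),
      0 < (1 - (Ideal.absNorm v.asIdeal : ℝ) ^ (-s))⁻¹ :=
    fun v => inv_pos.mpr (by linarith [hx2 v])
  refine hA.trans ?_
  rw [← Real.log_le_iff_le_exp (Finset.prod_pos fun v _ => hpos v),
    Real.log_prod (fun v _ => (hpos v).ne')]
  have h2 : ∑ v ∈ A, (Ideal.absNorm v.asIdeal : ℝ) ^ (-2 : ℝ) ≤ _ :=
    (summable_prime_rpow one_lt_two).sum_le_tsum A (fun _ _ => by positivity)
  have h3 : ∑ v ∈ A, (Ideal.absNorm v.asIdeal : ℝ) ^ (-s) ≤ _ :=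
    (summable_prime_rpow hs).sum_le_tsum A (fun _ _ => by positivity)
  have h4 : ∑ v ∈ A, Real.log (1 - (Ideal.absNorm v.asIdeal : ℝ) ^ (-s))⁻¹ ≤
      ∑ v ∈ A, ((Ideal.absNorm v.asIdeal : ℝ) ^ (-s) +
        2 * (Ideal.absNorm v.asIdeal : ℝ) ^ (-2 : ℝ)) := by
    refine Finset.sum_le_sum fun v _ => ?_
    rw [Real.log_inv]
    linarith [absNorm_rpow_sq_le v hs.le, neg_log_one_sub_le (by positivity) (hx2 v)]
  rw [Finset.sum_add_distrib, ← Finset.mul_sum] at h4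
  linarith

variable (K) in
/-- `∑_𝔭 N(𝔭)^{-s} = -log (s - 1) + O(1)` as `s → 1⁺`. -/
theorem exists_abs_tsum_prime_add_log_le :
    ∃ C : ℝ, ∀ᶠ s : ℝ in nhdsWithin 1 (Set.Ioi 1),
      |∑' v : HeightOneSpectrum (𝓞 K), (Ideal.absNorm v.asIdeal : ℝ) ^ (-s) +
        Real.log (s - 1)| ≤ C := by
  set D := ∑' v : HeightOneSpectrum (𝓞 K), (Ideal.absNorm v.asIdeal : ℝ) ^ (-2 : ℝ) with hD
  have hD0 : 0 ≤ D := tsum_nonneg fun v => by positivity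
  have hlim := (tendsto_sub_one_mul_tsum_absNorm K).log (dedekindZeta_residue_ne_zero K)
  refine ⟨|Real.log (dedekindZeta_residue K)| + 1 + 2 * D, ?_⟩
  filter_upwards [self_mem_nhdsWithin, hlim.abs.eventually_lt_const (lt_add_one _)] with s hs hlt
  have hs : 1 < s := hs
  have h1 := one_le_tsum_absNorm (K := K) hs
  rw [Real.log_mul (by linarith) (by linarith)] at hlt
  have h2 := tsum_prime_sub_le_log (K := K) hs
  have h3 := log_tsum_le (K := K) hs
  rw [abs_lt] at hlt
  rw [abs_le]
  constructor <;> linarith [hlt.1, hlt.2]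

end Analytic

section Completion

variable {K : Type*} [Field K] [NumberField K] (v : HeightOneSpectrum (𝓞 K))

theorem valued_algebraMap (k : K) :
    Valued.v (algebraMap K (v.adicCompletion K) k) = v.valuation K k :=
  HeightOneSpectrum.valuedAdicCompletion_eq_valuation' v k

theorem valued_algebraMap_lt_one_iff (a : 𝓞 K) :
    Valued.v (algebraMap K (v.adicCompletion K) (a : K)) < 1 ↔ a ∈ v.asIdeal := by
  rw [valued_algebraMap]
  exact HeightOneSpectrum.valuation_lt_one_iff_mem v a

theorem mem_maximalIdeal_adicCompletionIntegers_iff (x : v.adicCompletionIntegers K) :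
    x ∈ IsLocalRing.maximalIdeal (v.adicCompletionIntegers K) ↔
      Valued.v (x : v.adicCompletion K) < 1 :=
  Valuation.mem_maximalIdeal_iff _ _

theorem exists_valued_sub_algebraMap_lt_one {x : v.adicCompletion K} (hx : Valued.v x ≤ 1) :
    ∃ a : 𝓞 K, Valued.v (x - algebraMap K (v.adicCompletion K) (a : K)) < 1 := by
  obtain ⟨k, hk⟩ := (HeightOneSpectrum.denseRange_algebraMap K v).exists_mem_open
    (s := {y : v.adicCompletion K | Valued.v (x - y) < 1})
    (by
      have h := (Valued.isOpen_ball (v.adicCompletion K) 1).preimage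
        (continuous_const.sub continuous_id : Continuous fun y : v.adicCompletion K => x - y)
      simpa [Set.preimage, Valuation.restrict_lt_one_iff] using h) ⟨x, by simp⟩
  have hk : Valued.v (x - algebraMap K (v.adicCompletion K) k) < 1 := hk
  have hk1 : Valued.v (algebraMap K (v.adicCompletion K) k) ≤ 1 := by
    have := Valued.v.map_sub x (x - algebraMap K (v.adicCompletion K) k)
    rw [sub_sub_cancel] at this
    exact this.trans (max_le hx hk.le)
  rw [valued_algebraMap] at hk1
  obtain ⟨a, ha⟩ := v.exists_valuation_sub_lt_of_integer hk1 1
  refine ⟨a, ?_⟩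
  have h2 : x - algebraMap K (v.adicCompletion K) (a : K) =
      (x - algebraMap K (v.adicCompletion K) k) -
        algebraMap K (v.adicCompletion K) ((a : K) - k) := by
    rw [map_sub]; ring
  rw [h2]
  refine (Valued.v.map_sub _ _).trans_lt (max_lt hk ?_)
  rw [valued_algebraMap]
  exact ha

instance finite_residueField_adicCompletionIntegers :
    Finite (IsLocalRing.ResidueField (v.adicCompletionIntegers K)) := by
  let f : 𝓞 K →+* IsLocalRing.ResidueField (v.adicCompletionIntegers K) :=
    (IsLocalRing.residue _).comp (algebraMap (𝓞 K) (v.adicCompletionIntegers K))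
  have hf : Function.Surjective f := by
    intro y
    obtain ⟨x, rfl⟩ := IsLocalRing.residue_surjective y
    obtain ⟨a, ha⟩ := exists_valued_sub_algebraMap_lt_one v x.2
    refine ⟨a, ?_⟩
    rw [← sub_eq_zero]
    change IsLocalRing.residue _ (algebraMap (𝓞 K) (v.adicCompletionIntegers K) a) - _ = 0
    rw [← map_sub, IsLocalRing.residue_eq_zero_iff, mem_maximalIdeal_adicCompletionIntegers_iff,
      ← Valuation.map_neg]
    convert ha using 2
    exact neg_sub _ _
  have hv : ∀ a ∈ v.asIdeal, f a = 0 := by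
    intro a ha
    change IsLocalRing.residue _ (algebraMap (𝓞 K) (v.adicCompletionIntegers K) a) = 0
    rw [IsLocalRing.residue_eq_zero_iff, mem_maximalIdeal_adicCompletionIntegers_iff]
    exact (valued_algebraMap_lt_one_iff v a).mpr ha
  have : Finite (𝓞 K ⧸ v.asIdeal) := v.asIdeal.finiteQuotientOfFreeOfNeBot v.ne_bot
  exact Finite.of_surjective (Ideal.Quotient.lift v.asIdeal f hv)
    (Ideal.Quotient.lift_surjective_of_surjective _ hv hf)

instance compactSpace_adicCompletionIntegers : CompactSpace (v.adicCompletionIntegers K) := by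
  refine Valued.integer.compactSpace_iff_completeSpace_and_isDiscreteValuationRing_and_finite_residueField.mpr
    ⟨?_, inferInstanceAs (IsDiscreteValuationRing (v.adicCompletionIntegers K)),
      finite_residueField_adicCompletionIntegers v⟩
  exact (Valued.isClosed_valuationSubring (v.adicCompletion K)).completeSpace_coe

open scoped Pointwise in
instance isAdicComplete_adicCompletionIntegers :
    IsAdicComplete (IsLocalRing.maximalIdeal (v.adicCompletionIntegers K))
      (v.adicCompletionIntegers K) where
  prec' f hf := by
    let S n : Set (v.adicCompletionIntegers K) :=
      f n +ᵥ ((IsLocalRing.maximalIdeal (v.adicCompletionIntegers K) ^ n :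
        Ideal (v.adicCompletionIntegers K)) : Set (v.adicCompletionIntegers K))
    have hS n : S (n + 1) ⊆ S n := by
      apply (Set.vadd_set_subset_vadd_set_iff.mpr (Ideal.pow_le_pow_right n.le_succ)).trans
      simpa [S] using (hf n.le_succ).symm
    have h n : IsClosed (S n) := (IsNoetherianRing.isClosed_ideal
      (IsLocalRing.maximalIdeal (v.adicCompletionIntegers K) ^ n)).vadd (f n)
    obtain ⟨L, hL⟩ := (h 0).isCompact.nonempty_iInter_of_sequence_nonempty_isCompact_isClosed S hS
      (by simp [S]) h
    refine ⟨L, fun n ↦ ?_⟩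
    obtain ⟨y, hy, rfl⟩ := Set.mem_iInter.mp hL n
    simpa [SModEq.sub_mem] using hy

end Completion

section Splitting

variable {K L : Type*} [Field K] [NumberField K] [Field L] [Algebra K L]

theorem Ideal.inertiaDeg_eq_one_iff_forall_exists_sub_mem {R S : Type*} [CommRing R] [CommRing S]
    [Algebra R S] (p : Ideal R) [p.IsMaximal] (P : Ideal S) [P.IsMaximal] [P.LiesOver p] :
    P.inertiaDeg R = 1 ↔ ∀ x : S, ∃ a : R, x - algebraMap R S a ∈ P := by
  rw [Ideal.inertiaDeg_eq_of_isMaximal p P]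
  let _ : Field (R ⧸ p) := Ideal.Quotient.field p
  have h : (⊥ : Subalgebra (R ⧸ p) (S ⧸ P)) = ⊤ ↔ ∀ x : S, ∃ a : R, x - algebraMap R S a ∈ P := by
    refine ⟨fun h x => ?_, fun h => ?_⟩
    · have hx : Ideal.Quotient.mk P x ∈ (⊥ : Subalgebra (R ⧸ p) (S ⧸ P)) := h ▸ Algebra.mem_top
      obtain ⟨y, hy⟩ := Algebra.mem_bot.mp hx
      obtain ⟨a, rfl⟩ := Ideal.Quotient.mk_surjective y
      refine ⟨a, Ideal.Quotient.eq.mp ?_⟩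
      rw [← hy]
      rfl
    · rw [eq_top_iff]
      intro y _
      obtain ⟨x, rfl⟩ := Ideal.Quotient.mk_surjective y
      obtain ⟨a, ha⟩ := h x
      refine Algebra.mem_bot.mpr ⟨Ideal.Quotient.mk p a, ?_⟩
      rw [Ideal.Quotient.eq.mpr ha]
      rfl
  rw [← h, Subalgebra.bot_eq_top_iff_finrank_eq_one]

theorem exists_prime_of_algHom (v : HeightOneSpectrum (𝓞 K)) (ψ : L →ₐ[K] v.adicCompletion K) :
    ∃ P : Ideal (𝓞 L), P.IsPrime ∧ P.LiesOver v.asIdeal ∧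
      ∀ x : 𝓞 L, ∃ a : 𝓞 K, x - algebraMap (𝓞 K) (𝓞 L) a ∈ P := by
  have hint : ∀ x : 𝓞 L, ψ (x : L) ∈ v.adicCompletionIntegers K := by
    intro x
    have h1 : IsIntegral ℤ (ψ (x : L)) := x.2.map (ψ.restrictScalars ℤ)
    exact (Valuation.valuationSubring.integers (Valued.v (R := v.adicCompletion K))).mem_of_integral
      h1.tower_top
  let f : 𝓞 L →+* v.adicCompletionIntegers K :=
    (ψ.toRingHom.comp (algebraMap (𝓞 L) L)).codRestrict (v.adicCompletionIntegers K) hint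
  let P : Ideal (𝓞 L) := (IsLocalRing.maximalIdeal (v.adicCompletionIntegers K)).comap f
  have hP : ∀ x : 𝓞 L, x ∈ P ↔ Valued.v (ψ (x : L)) < 1 := fun x =>
    mem_maximalIdeal_adicCompletionIntegers_iff v (f x)
  have hψ : ∀ a : 𝓞 K, ψ ((algebraMap (𝓞 K) (𝓞 L) a : 𝓞 L) : L) =
      algebraMap K (v.adicCompletion K) (a : K) := by
    intro a
    rw [← ψ.commutes]
    rfl
  refine ⟨P, inferInstance, ⟨?_⟩, fun x => ?_⟩
  · ext a
    rw [Ideal.under_def, Ideal.mem_comap, hP, hψ, valued_algebraMap_lt_one_iff]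
  · obtain ⟨a, ha⟩ := exists_valued_sub_algebraMap_lt_one v (hint x)
    refine ⟨a, ?_⟩
    rw [hP]
    have h2 : ψ ((x - algebraMap (𝓞 K) (𝓞 L) a : 𝓞 L) : L) =
        ψ (x : L) - algebraMap K (v.adicCompletion K) (a : K) := by
      rw [← hψ, ← map_sub]
      rfl
    rw [h2]
    exact ha

variable [NumberField L]

theorem nonempty_algHom_of_derivative_notMem (v : HeightOneSpectrum (𝓞 K)) (θ : 𝓞 L)
    (hθ : IntermediateField.adjoin K {(θ : L)} = ⊤) (P : Ideal (𝓞 L)) [P.IsPrime]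
    [P.LiesOver v.asIdeal] (hP : ∀ x : 𝓞 L, ∃ a : 𝓞 K, x - algebraMap (𝓞 K) (𝓞 L) a ∈ P)
    (hd : aeval θ (derivative (minpoly (𝓞 K) θ)) ∉ P) :
    Nonempty (L →ₐ[K] v.adicCompletion K) := by
  obtain ⟨a, ha⟩ := hP θ
  set g := minpoly (𝓞 K) θ with hg
  have hmem : ∀ q : (𝓞 K)[X], q.eval a ∈ v.asIdeal ↔ aeval θ q ∈ P := by
    intro q
    have h1 : aeval θ q - algebraMap (𝓞 K) (𝓞 L) (q.eval a) ∈ P := by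
      rw [← Polynomial.aeval_algebraMap_apply_eq_algebraMap_eval, ← eval_map_algebraMap,
        ← eval_map_algebraMap]
      exact P.mem_of_dvd (Polynomial.sub_dvd_eval_sub _ _ _) ha
    rw [Ideal.mem_of_liesOver P v.asIdeal, ← P.add_mem_iff_right h1,
      sub_add_cancel]
  have hga : g.eval a ∈ v.asIdeal := by
    rw [hmem, minpoly.aeval]; exact P.zero_mem
  have hda : (derivative g).eval a ∉ v.asIdeal := by rwa [hmem]
  have hgm : g.Monic := minpoly.monic (Algebra.IsIntegral.isIntegral θ)
  let ι : 𝓞 K →+* v.adicCompletionIntegers K := algebraMap (𝓞 K) (v.adicCompletionIntegers K)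
  have hι : ∀ b, ι b ∈ IsLocalRing.maximalIdeal (v.adicCompletionIntegers K) ↔ b ∈ v.asIdeal :=
    fun b => (mem_maximalIdeal_adicCompletionIntegers_iff v _).trans
      (valued_algebraMap_lt_one_iff v b)
  have hH := IsAdicComplete.henselianRing (v.adicCompletionIntegers K)
    (IsLocalRing.maximalIdeal (v.adicCompletionIntegers K))
  obtain ⟨y, hy, -⟩ := hH.is_henselian (g.map ι) (hgm.map ι) (ι a)
    (by rw [Polynomial.eval_map_apply, hι]; exact hga)
    (by
      apply IsUnit.map
      rw [← IsLocalRing.notMem_maximalIdeal, derivative_map, Polynomial.eval_map_apply, hι]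
      exact hda)
  have hint : IsIntegral K (θ : L) := Algebra.IsIntegral.isIntegral _
  have hroot : aeval (y : v.adicCompletion K) (minpoly K (θ : L)) = 0 := by
    have hmp : minpoly K (θ : L) = g.map (algebraMap (𝓞 K) K) :=
      minpoly.isIntegrallyClosed_eq_field_fractions K L (Algebra.IsIntegral.isIntegral θ)
    rw [hmp, aeval_def, eval₂_map]
    have h1 := congrArg (v.adicCompletionIntegers K).subtype hy
    rw [eval_map, hom_eval₂, map_zero] at h1
    exact h1
  let pb := IntermediateField.adjoin.powerBasis hint
  let e : IntermediateField.adjoin K {(θ : L)} ≃ₐ[K] L :=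
    (IntermediateField.equivOfEq hθ).trans IntermediateField.topEquiv
  exact ⟨(pb.lift (y : v.adicCompletion K) (by
    rw [IntermediateField.adjoin.powerBasis_gen, IntermediateField.minpoly_gen]; exact hroot)).comp
      e.symm.toAlgHom⟩

end Splitting

section Galois

theorem smul_sub_self_ne_zero {K L : Type*} [Field K] [Field L] [Algebra K L] (θ : 𝓞 L)
    (hθ : IntermediateField.adjoin K {(θ : L)} = ⊤)
    {σ : Gal(L/K)} (hσ : σ ≠ 1) : σ • θ - θ ≠ 0 := by
  intro h
  apply hσ
  have h1 : σ (θ : L) = θ := congrArg (algebraMap (𝓞 L) L) (sub_eq_zero.mp h)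
  have h2 : (σ : L →ₐ[K] L).comp (IntermediateField.adjoin K {(θ : L)}).val =
      (IntermediateField.adjoin K {(θ : L)}).val := by
    refine IntermediateField.adjoin_algHom_ext K fun x hx => ?_
    obtain rfl : x = θ := hx
    exact h1
  ext x
  exact DFunLike.congr_fun h2 ⟨x, hθ ▸ IntermediateField.mem_top⟩

variable {K L : Type*} [Field K] [NumberField K] [Field L] [NumberField L] [Algebra K L]

variable (K) in
/-- The prime of `K` below a prime of `L`. -/
noncomputable def IsDedekindDomain.HeightOneSpectrum.below (w : HeightOneSpectrum (𝓞 L)) :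
    HeightOneSpectrum (𝓞 K) where
  asIdeal := w.asIdeal.under (𝓞 K)
  isPrime := inferInstance
  ne_bot := Ideal.IsIntegral.comap_ne_bot _ w.ne_bot

instance IsDedekindDomain.HeightOneSpectrum.liesOver_below (w : HeightOneSpectrum (𝓞 L)) :
    w.asIdeal.LiesOver (HeightOneSpectrum.below K w).asIdeal := ⟨rfl⟩

/-- The primes of `L` lying over `v`, as elements of the height one spectrum. -/
noncomputable def IsDedekindDomain.HeightOneSpectrum.fiberEquivPrimesOver
    (v : HeightOneSpectrum (𝓞 K)) :
    {w : HeightOneSpectrum (𝓞 L) // HeightOneSpectrum.below K w = v} ≃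
      v.asIdeal.primesOver (𝓞 L) where
  toFun w := ⟨w.1.asIdeal, w.1.isPrime, ⟨congrArg HeightOneSpectrum.asIdeal w.2.symm⟩⟩
  invFun P := ⟨⟨P.1, P.2.1, Ideal.ne_bot_of_mem_primesOver v.ne_bot P.2⟩,
    HeightOneSpectrum.ext P.2.2.over.symm⟩
  left_inv _ := rfl
  right_inv _ := rfl

instance (v : HeightOneSpectrum (𝓞 K)) : PerfectField v.asIdeal.ResidueField := by
  have : Finite (𝓞 K ⧸ v.asIdeal) := v.asIdeal.finiteQuotientOfFreeOfNeBot v.ne_bot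
  have := v.isMaximal
  have : Finite v.asIdeal.ResidueField :=
    Finite.of_surjective _ v.asIdeal.bijective_algebraMap_quotient_residueField.2
  infer_instance

variable (K L) in
theorem exists_integral_primitive_element :
    ∃ θ : 𝓞 L, IntermediateField.adjoin K {(θ : L)} = ⊤ := by
  obtain ⟨α, hα⟩ := Field.exists_primitive_element K L
  obtain ⟨c, hc, hint⟩ := ((IsFractionRing.isAlgebraic_iff ℤ ℚ L).mpr
    (Algebra.IsAlgebraic.isAlgebraic α)).exists_integral_multiple
  refine ⟨⟨c • α, hint⟩, ?_⟩
  rw [eq_top_iff, ← hα, IntermediateField.adjoin_simple_le_iff]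
  have h1 : c • α ∈ IntermediateField.adjoin K {c • α} :=
    IntermediateField.mem_adjoin_simple_self K _
  have h2 : ((c : K)⁻¹) • (c • α) = α := by
    rw [← Int.cast_smul_eq_zsmul K c α, inv_smul_smul₀ (Int.cast_ne_zero.mpr hc)]
  have h3 := IntermediateField.smul_mem _ h1 (x := (c : K)⁻¹)
  rwa [h2] at h3

theorem aeval_derivative_minpoly_ne_zero (θ : 𝓞 L) :
    aeval θ (derivative (minpoly (𝓞 K) θ)) ≠ 0 := by
  intro h
  have hmp : minpoly K (θ : L) = (minpoly (𝓞 K) θ).map (algebraMap (𝓞 K) K) :=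
    minpoly.isIntegrallyClosed_eq_field_fractions K L (Algebra.IsIntegral.isIntegral θ)
  have hs : (minpoly K (θ : L)).Separable := Algebra.IsSeparable.isSeparable K (θ : L)
  refine hs.aeval_derivative_ne_zero (minpoly.aeval K (θ : L)) ?_
  rw [hmp, derivative_map, aeval_map_algebraMap]
  have := congrArg (algebraMap (𝓞 L) L) h
  rw [map_zero] at this
  rw [← this, ← aeval_algebraMap_apply]

variable (L) in
theorem card_below_fiber_le [IsGalois K L] (v : HeightOneSpectrum (𝓞 K)) :
    Finite {w : HeightOneSpectrum (𝓞 L) // HeightOneSpectrum.below K w = v} ∧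
    Nat.card {w : HeightOneSpectrum (𝓞 L) // HeightOneSpectrum.below K w = v} ≤
      Module.finrank K L := by
  have := v.isMaximal
  have h := Ideal.ncard_primesOver_mul_ramificationIdxIn_mul_inertiaDegIn v.asIdeal (𝓞 L) Gal(L/K)
  rw [IsGalois.card_aut_eq_finrank] at h
  have hpos : 0 < Module.finrank K L := Module.finrank_pos
  have hcard : Nat.card {w : HeightOneSpectrum (𝓞 L) // HeightOneSpectrum.below K w = v} =
      (v.asIdeal.primesOver (𝓞 L)).ncard :=
    Nat.card_congr (HeightOneSpectrum.fiberEquivPrimesOver v)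
  have hne : Nat.card {w : HeightOneSpectrum (𝓞 L) // HeightOneSpectrum.below K w = v} ≠ 0 := by
    rw [hcard]
    rintro h0
    rw [h0, zero_mul] at h
    omega
  refine ⟨Nat.finite_of_card_ne_zero hne, ?_⟩
  rw [hcard, ← h]
  refine Nat.le_mul_of_pos_right _ (Nat.pos_of_ne_zero ?_)
  rintro h0
  rw [h0, mul_zero] at h
  omega

variable (K L) in
/-- Away from a finite set of primes, a prime `v` of `K` with a `K`-embedding of `L` in `K_v` splits
completely in the Galois extension `L`, and otherwise all primes over `v` have residue degree at
least two. -/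
theorem exists_finite_forall_notMem_splitting [IsGalois K L] :
    ∃ E : Set (HeightOneSpectrum (𝓞 K)), E.Finite ∧ ∀ v ∉ E,
      (Nonempty (L →ₐ[K] v.adicCompletion K) →
        Nat.card {w : HeightOneSpectrum (𝓞 L) // HeightOneSpectrum.below K w = v} =
          Module.finrank K L ∧
        ∀ w : HeightOneSpectrum (𝓞 L), HeightOneSpectrum.below K w = v →
          Ideal.absNorm w.asIdeal = Ideal.absNorm v.asIdeal) ∧
      (¬ Nonempty (L →ₐ[K] v.adicCompletion K) →
        ∀ w : HeightOneSpectrum (𝓞 L), HeightOneSpectrum.below K w = v →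
          Ideal.absNorm v.asIdeal ^ 2 ≤ Ideal.absNorm w.asIdeal) := by
  classical
  obtain ⟨θ, hθ⟩ := exists_integral_primitive_element K L
  set d : 𝓞 L := aeval θ (derivative (minpoly (𝓞 K) θ)) *
    ∏ σ ∈ (Finset.univ : Finset Gal(L/K)).erase 1, (σ • θ - θ) with hd
  have hd0 : d ≠ 0 := mul_ne_zero (aeval_derivative_minpoly_ne_zero θ)
    (Finset.prod_ne_zero_iff.mpr fun σ hσ =>
      smul_sub_self_ne_zero θ hθ (Finset.mem_erase.mp hσ).1)
  refine ⟨HeightOneSpectrum.below K '' {w : HeightOneSpectrum (𝓞 L) | w.asIdeal ∣ Ideal.span {d}},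
    (Ideal.finite_factors (by simpa using hd0)).image _, fun v hv => ?_⟩
  have hdw : ∀ w : HeightOneSpectrum (𝓞 L), HeightOneSpectrum.below K w = v → d ∉ w.asIdeal := by
    intro w hw hdw
    exact hv ⟨w, Ideal.dvd_span_singleton.mpr hdw, hw⟩
  have := v.isMaximal
  refine ⟨?_, ?_⟩
  · rintro ⟨ψ⟩
    obtain ⟨P, hPprime, hPover, hP⟩ := exists_prime_of_algHom v ψ
    let w₀ : {w : HeightOneSpectrum (𝓞 L) // HeightOneSpectrum.below K w = v} :=
      (HeightOneSpectrum.fiberEquivPrimesOver v).symm ⟨P, hPprime, hPover⟩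
    have hPmax : P.IsMaximal := w₀.1.isMaximal
    have hdP : d ∉ P := hdw w₀.1 w₀.2
    have hdeg : P.inertiaDeg (𝓞 K) = 1 :=
      (Ideal.inertiaDeg_eq_one_iff_forall_exists_sub_mem v.asIdeal P).mpr hP
    constructor
    · have h := Ideal.ncard_primesOver_mul_card_inertia_mul_finrank (G := Gal(L/K)) v.asIdeal P
      have hI : Ideal.inertia Gal(L/K) P = ⊥ := by
        rw [eq_bot_iff]
        intro σ hσ
        by_contra hne
        apply hdP
        rw [hd]
        refine P.mul_mem_left _ (P.mem_of_dvd (Finset.dvd_prod_of_mem _ (Finset.mem_erase.mpr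
          ⟨hne, Finset.mem_univ σ⟩)) (hσ θ))
      rw [hdeg, hI, IsGalois.card_aut_eq_finrank, Subgroup.card_bot, mul_one, mul_one] at h
      rw [← h]
      exact Nat.card_congr (HeightOneSpectrum.fiberEquivPrimesOver v)
    · rintro w hw
      have hwo : w.asIdeal.LiesOver v.asIdeal := by rw [← hw]; infer_instance
      rw [← Ideal.absNorm_pow_inertiaDeg v.asIdeal w.asIdeal,
        Ideal.inertiaDeg_eq_of_isGaloisGroup v.asIdeal w.asIdeal P Gal(L/K), hdeg, pow_one]
  · intro hψ w hw
    have hwo : w.asIdeal.LiesOver v.asIdeal := by rw [← hw]; infer_instance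
    have hwmax := w.isMaximal
    have hnorm := Ideal.absNorm_pow_inertiaDeg v.asIdeal w.asIdeal
    have hd1 : w.asIdeal.inertiaDeg (𝓞 K) ≠ 1 := by
      intro h1
      rw [Ideal.inertiaDeg_eq_one_iff_forall_exists_sub_mem v.asIdeal w.asIdeal] at h1
      exact hψ (nonempty_algHom_of_derivative_notMem v θ hθ w.asIdeal h1
        fun h => hdw w hw (w.asIdeal.mul_mem_right _ h))
    have h1w := HeightOneSpectrum.one_lt_absNorm w
    have h1v := HeightOneSpectrum.one_lt_absNorm v
    have hd0 : w.asIdeal.inertiaDeg (𝓞 K) ≠ 0 := by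
      intro h0
      rw [h0, pow_zero] at hnorm
      omega
    rw [← hnorm]
    exact Nat.pow_le_pow_right (by omega) (by omega)

end Galois

section Density

variable {K L : Type*} [Field K] [NumberField K] [Field L] [NumberField L] [Algebra K L]

variable (K L) in
theorem exists_abs_tsum_sub_finrank_mul_tsum_le [IsGalois K L] :
    ∃ C : ℝ, ∀ s : ℝ, 1 < s →
      |∑' w : HeightOneSpectrum (𝓞 L), (Ideal.absNorm w.asIdeal : ℝ) ^ (-s) -
        Module.finrank K L *
          ∑' v : {v : HeightOneSpectrum (𝓞 K) | Nonempty (L →ₐ[K] v.adicCompletion K)},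
            (Ideal.absNorm v.1.asIdeal : ℝ) ^ (-s)| ≤ C := by
  classical
  obtain ⟨E, hE, hsplit⟩ := exists_finite_forall_notMem_splitting K L
  set n := Module.finrank K L with hn
  set S := {v : HeightOneSpectrum (𝓞 K) | Nonempty (L →ₐ[K] v.adicCompletion K)} with hS
  let b : HeightOneSpectrum (𝓞 K) → ℝ := fun v =>
    n * (Ideal.absNorm v.asIdeal : ℝ) ^ (-2 : ℝ) + E.indicator (fun _ => (n : ℝ)) v
  have hb : Summable b := ((summable_prime_rpow one_lt_two).mul_left _).add
    (summable_of_hasFiniteSupport (hE.subset Set.support_indicator_subset))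
  refine ⟨∑' v, b v, fun s hs => ?_⟩
  let a : HeightOneSpectrum (𝓞 K) → ℝ := fun v =>
    ∑' w : {w : HeightOneSpectrum (𝓞 L) // HeightOneSpectrum.below K w = v},
      (Ideal.absNorm w.1.asIdeal : ℝ) ^ (-s)
  let f : HeightOneSpectrum (𝓞 K) → ℝ :=
    S.indicator fun v => (Ideal.absNorm v.asIdeal : ℝ) ^ (-s)
  have hsum : Summable fun w : HeightOneSpectrum (𝓞 L) =>
      (Ideal.absNorm w.asIdeal : ℝ) ^ (-s) := summable_prime_rpow hs
  have hsigma : Summable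
      fun c : (v : HeightOneSpectrum (𝓞 K)) ×
        {w : HeightOneSpectrum (𝓞 L) // HeightOneSpectrum.below K w = v} =>
      (Ideal.absNorm c.2.1.asIdeal : ℝ) ^ (-s) :=
    (Equiv.sigmaFiberEquiv (HeightOneSpectrum.below K (L := L))).summable_iff.mpr hsum
  have hA : ∑' w : HeightOneSpectrum (𝓞 L), (Ideal.absNorm w.asIdeal : ℝ) ^ (-s) =
      ∑' v, a v := by
    rw [← (Equiv.sigmaFiberEquiv (HeightOneSpectrum.below K (L := L))).tsum_eq]
    exact hsigma.tsum_sigma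
  have ha : Summable a := hsigma.sigma
  have hf : Summable f := (summable_prime_rpow hs).indicator S
  have hpoint : ∀ v, ‖a v - n * f v‖ ≤ b v := by
    intro v
    rw [Real.norm_eq_abs]
    obtain ⟨hfin, hcard⟩ := card_below_fiber_le L v
    have hft := Fintype.ofFinite
      {w : HeightOneSpectrum (𝓞 L) // HeightOneSpectrum.below K w = v}
    have hav : a v = ∑ w : {w : HeightOneSpectrum (𝓞 L) // HeightOneSpectrum.below K w = v},
      (Ideal.absNorm w.1.asIdeal : ℝ) ^ (-s) := tsum_fintype _
    rw [Nat.card_eq_fintype_card] at hcard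
    have hle : ∀ t : ℝ, 0 ≤ t → (∀ w : {w : HeightOneSpectrum (𝓞 L) //
        HeightOneSpectrum.below K w = v}, (Ideal.absNorm w.1.asIdeal : ℝ) ^ (-s) ≤ t) →
        a v ≤ n * t := by
      intro t ht h
      rw [hav]
      refine (Finset.sum_le_card_nsmul _ _ t fun w _ => h w).trans ?_
      rw [nsmul_eq_mul, Finset.card_univ]
      exact mul_le_mul_of_nonneg_right (by exact_mod_cast hcard) ht
    have ha0 : 0 ≤ a v := tsum_nonneg fun w => by positivity
    have hn2 : 0 ≤ n * (Ideal.absNorm v.asIdeal : ℝ) ^ (-2 : ℝ) := by positivity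
    have hbv : b v = n * (Ideal.absNorm v.asIdeal : ℝ) ^ (-2 : ℝ) +
      E.indicator (fun _ => (n : ℝ)) v := rfl
    by_cases hv : v ∈ E
    · rw [hbv, Set.indicator_of_mem hv]
      have h1 : a v ≤ n * 1 := hle 1 zero_le_one fun w => by
        linarith [absNorm_rpow_neg_le_half w.1 hs.le]
      have hf0 : 0 ≤ f v := Set.indicator_nonneg (fun v _ => by positivity) v
      have hf1 : f v ≤ 1 := Set.indicator_apply_le' (fun _ => by
        linarith [absNorm_rpow_neg_le_half v hs.le]) fun _ => zero_le_one
      have h2 : n * f v ≤ n * 1 := mul_le_mul_of_nonneg_left hf1 (Nat.cast_nonneg n)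
      have h3 : 0 ≤ n * f v := by positivity
      rw [abs_le]
      constructor <;> linarith
    · rw [hbv, Set.indicator_of_notMem hv, add_zero]
      by_cases hvS : v ∈ S
      · obtain ⟨hc, hN⟩ := (hsplit v hv).1 hvS
        have : a v = n * f v := by
          rw [hav, Finset.sum_congr rfl (g := fun _ => (Ideal.absNorm v.asIdeal : ℝ) ^ (-s))
            (fun w _ => by rw [hN w.1 w.2]), Finset.sum_const, nsmul_eq_mul, Finset.card_univ,
            ← Nat.card_eq_fintype_card, hc]
          exact congrArg _ (Set.indicator_of_mem hvS
            fun v => (Ideal.absNorm v.asIdeal : ℝ) ^ (-s)).symm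
        rw [this, sub_self, abs_zero]
        exact hn2
      · have hN := (hsplit v hv).2 hvS
        have hfv : f v = 0 := Set.indicator_of_notMem hvS _
        rw [hfv, mul_zero, sub_zero, abs_of_nonneg ha0]
        refine hle _ (by positivity) fun w => (le_trans ?_ (absNorm_rpow_sq_le v hs.le))
        have h2 := two_le_absNorm v
        rw [← Real.rpow_natCast, ← Real.rpow_mul (by positivity), mul_comm,
          Real.rpow_mul (by positivity), Real.rpow_natCast]
        refine Real.rpow_le_rpow_of_nonpos (by positivity) ?_ (by linarith)
        exact_mod_cast hN w.1 w.2
  rw [hA, tsum_subtype S (fun v => (Ideal.absNorm v.asIdeal : ℝ) ^ (-s)), ← tsum_mul_left,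
    ← ha.tsum_sub (hf.mul_left _)]
  exact tsum_of_norm_bounded hb.hasSum hpoint

variable (K L) in
/-- The primes `v` of `K` such that the Galois extension `L` embeds in `K_v` have Dirichlet density
`1 / [L : K]`. -/
theorem hasDirichletDensity_setOf_nonempty_algHom [IsGalois K L] :
    HasDirichletDensity K
      {v : HeightOneSpectrum (𝓞 K) | Nonempty (L →ₐ[K] v.adicCompletion K)}
      (1 / Module.finrank K L) := by
  obtain ⟨C₁, h₁⟩ := exists_abs_tsum_sub_finrank_mul_tsum_le K L
  obtain ⟨C₂, h₂⟩ := exists_abs_tsum_prime_add_log_le L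
  have hn : (0 : ℝ) < Module.finrank K L := by exact_mod_cast Module.finrank_pos
  have hlog : Tendsto (fun s : ℝ => -Real.log (s - 1)) (nhdsWithin 1 (Set.Ioi 1)) atTop := by
    refine tendsto_neg_atBot_atTop.comp (Real.tendsto_log_nhdsGT_zero.comp ?_)
    refine tendsto_nhdsWithin_iff.mpr ⟨?_, ?_⟩
    · have : Tendsto (fun s : ℝ => s - 1) (nhds 1) (nhds (1 - 1)) :=
        (continuous_id.sub continuous_const).tendsto 1
      rw [sub_self] at this
      exact this.mono_left nhdsWithin_le_nhds
    · filter_upwards [self_mem_nhdsWithin] with s hs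
      exact Set.mem_Ioi.mpr (sub_pos.mpr (Set.mem_Ioi.mp hs))
  rw [HasDirichletDensity, tendsto_iff_norm_sub_tendsto_zero]
  have hz : Tendsto (fun s : ℝ => ((C₁ + C₂) / Module.finrank K L) / (-Real.log (s - 1)))
      (nhdsWithin 1 (Set.Ioi 1)) (nhds 0) := hlog.const_div_atTop _
  refine squeeze_zero' (Eventually.of_forall fun s => norm_nonneg _) ?_ hz
  filter_upwards [self_mem_nhdsWithin, h₂, hlog.eventually_gt_atTop 0] with s hs h2 hpos
  have h1 := h₁ s hs
  set D := ∑' v : {v : HeightOneSpectrum (𝓞 K) | Nonempty (L →ₐ[K] v.adicCompletion K)},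
    (Ideal.absNorm v.1.asIdeal : ℝ) ^ (-s)
  set A := ∑' w : HeightOneSpectrum (𝓞 L), (Ideal.absNorm w.asIdeal : ℝ) ^ (-s)
  set l := -Real.log (s - 1) with hl
  have hle : |Module.finrank K L * D - l| ≤ C₁ + C₂ := by
    rw [abs_le] at h1 h2 ⊢
    constructor <;> linarith [h1.1, h1.2, h2.1, h2.2]
  have heq : D / l - 1 / Module.finrank K L =
      (Module.finrank K L * D - l) / Module.finrank K L / l := by
    field_simp
  rw [heq, Real.norm_eq_abs, abs_div, abs_div, abs_of_pos hpos, abs_of_pos hn]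
  gcongr

end Density

theorem exists_aeval_eq_zero_iff_nonempty_algHom {K M : Type*} [Field K] [Field M] [Algebra K M]
    {F : K[X]} (hF : Irreducible F)
    (hsplit : Module.finrank K F.SplittingField = F.natDegree) :
    (∃ x : M, aeval x F = 0) ↔ Nonempty (F.SplittingField →ₐ[K] M) := by
  have := Fact.mk hF
  obtain ⟨α, hα⟩ := (SplittingField.splits F).exists_eval_eq_zero
    (by rw [degree_map]; exact hF.degree_pos.ne')
  have hα : aeval α F = 0 := by rwa [eval_map_algebraMap] at hα
  constructor
  · rintro ⟨x, hx⟩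
    let i : AdjoinRoot F →ₐ[K] F.SplittingField :=
      AdjoinRoot.liftAlgHom F (Algebra.ofId K _) α hα
    have hfin : Module.finrank K (AdjoinRoot F) = Module.finrank K F.SplittingField := by
      rw [hsplit, (AdjoinRoot.powerBasis hF.ne_zero).finrank, AdjoinRoot.powerBasis_dim]
    have : FiniteDimensional K (AdjoinRoot F) := (AdjoinRoot.powerBasis hF.ne_zero).finite
    have hi : Function.Bijective i := ⟨i.injective,
      (LinearMap.injective_iff_surjective_of_finrank_eq_finrank (f := i.toLinearMap) hfin).mp
        i.injective⟩
    exact ⟨(AdjoinRoot.liftAlgHom F (Algebra.ofId K _) x hx).comp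
      (AlgEquiv.ofBijective i hi).symm.toAlgHom⟩
  · rintro ⟨ψ⟩
    exact ⟨ψ α, by rw [aeval_algHom_apply, hα, map_zero]⟩

/-- If `F ∈ K[x]` is irreducible and its splitting field `L` has `[L : K] = deg F`, then
the set of primes `𝔭` of `K` for which `F` has a root in `K_𝔭` has Dirichlet density
`1 / deg F`. -/
theorem stmt_9 {K : Type*} [Field K] [NumberField K] (F : K[X])
    (hF : Irreducible F)
    (hsplit : Module.finrank K F.SplittingField = F.natDegree) :
    HasDirichletDensity K
      {v : HeightOneSpectrum (𝓞 K) | ∃ x : v.adicCompletion K, aeval x F = 0}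
      (1 / F.natDegree) := by
  have := NumberField.of_module_finite K F.SplittingField
  have : IsGalois K F.SplittingField := IsGalois.mk
  rw [← hsplit]
  convert hasDirichletDensity_setOf_nonempty_algHom K F.SplittingField using 1
  ext v
  exact exists_aeval_eq_zero_iff_nonempty_algHom hF hsplit
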